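/- arXiv:1604.03270 — 2 statements merged into one kernel-verified Lean document; each statement's English description precedes it below -/
import Mathlib

section
/- Let A=(Q,Σ,δ,ρ) be a reversible Mealy automaton, n≥1, u∈Q^n and x∈Q. Let C be the connected component of u in A^n and D the connected component of u·x in A^{n+1}. Then for every v∈C there exists y∈Q with v·y∈D, and the cardinality #C divides the cardinality #D. -/
open List

variable {Q A : Type*}

/-- Action of a state on words over the alphabet:
`ρ_x(i·s) = ρ_x(i) · ρ_{δ_i(x)}(s)`. -/
def mrho (d : A → Q → Q) (r : Q → A → A) : Q → List A → List A
  | _, [] => []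
  | x, i :: s => r x i :: mrho d r (d i x) s

/-- Action of a word of states: `ρ_{x₁⋯x_m} = ρ_{x_m} ∘ ⋯ ∘ ρ_{x₁}`. -/
def mrhoW (d : A → Q → Q) (r : Q → A → A) : List Q → List A → List A
  | [], s => s
  | x :: u, s => mrhoW d r u (mrho d r x s)

/-- Dual action of a letter on words of states:
`δ_i(x·u) = δ_i(x) · δ_{ρ_x(i)}(u)`. -/
def mdel (d : A → Q → Q) (r : Q → A → A) : A → List Q → List Q
  | _, [] => []
  | i, x :: u => d i x :: mdel d r (r x i) u

/-- Action of a word of letters: `δ_{s₁⋯s_m} = δ_{s_m} ∘ ⋯ ∘ δ_{s₁}`. -/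
def mdelW (d : A → Q → Q) (r : Q → A → A) : List A → List Q → List Q
  | [], u => u
  | i :: s, u => mdelW d r s (mdel d r i u)

/-- Connected component (orbit under the dual action) of a word of states. -/
def mOrbit (d : A → Q → Q) (r : Q → A → A) (u : List Q) : Set (List Q) :=
  { v | ∃ s : List A, mdelW d r s u = v }

/-- The Mealy automaton is invertible. -/
def MInvertible (r : Q → A → A) : Prop := ∀ x : Q, Function.Bijective (r x)

/-- The Mealy automaton is reversible. -/
def MReversible (d : A → Q → Q) : Prop := ∀ i : A, Function.Bijective (d i)

/-- The Mealy automaton is connected. -/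
def MConnected (d : A → Q → Q) (r : Q → A → A) : Prop :=
  ∀ x y : Q, ∃ s : List A, mdelW d r s [x] = [y]

/-- The Mealy automaton is bireversible: invertible, reversible, and for each output
letter `j`, the map sending `x` to `δ_i(x)` (where `i` is the unique letter with
`ρ_x(i) = j`) is a permutation of the (finite) stateset, encoded as injectivity. -/
def MBireversible (d : A → Q → Q) (r : Q → A → A) : Prop :=
  MInvertible r ∧ MReversible d ∧
    ∀ (x y : Q) (i i' : A), r x i = r y i' → d i x = d i' y → x = y

/-- The edge of the orbit tree whose bottom is the component of `e` is liftable
to the edge whose bottom is the component of `f`: every word of `⊥(e)` admits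
some word of `⊥(f)` as a suffix. -/
def EdgeLiftable (d : A → Q → Q) (r : Q → A → A) (e f : List Q) : Prop :=
  ∀ v ∈ mOrbit d r e, ∃ v' ∈ mOrbit d r f, v' <:+ v

theorem aux_inj (d : A → Q → Q) (r : Q → A → A) (hrev : MReversible d) :
    ∀ (v w : List Q) (i : A), mdel d r i v = mdel d r i w → v = w
  | [], [], _, _ => rfl
  | [], _ :: _, _, h => by simp [mdel] at h
  | _ :: _, [], _, h => by simp [mdel] at h
  | a :: v, b :: w, i, h => by
    simp only [mdel, List.cons.injEq] at h
    obtain ⟨h1, h2⟩ := h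
    have := (hrev i).1 h1
    subst this
    rw [aux_inj d r hrev v w _ h2]

theorem aux_injW (d : A → Q → Q) (r : Q → A → A) (hrev : MReversible d) (s : List A) :
    Function.Injective (mdelW d r s) := by
  induction s with
  | nil => exact fun _ _ h => h
  | cons i s ih => exact fun v w h => aux_inj d r hrev v w i (ih h)

theorem aux_len (d : A → Q → Q) (r : Q → A → A) :
    ∀ (v : List Q) (i : A), (mdel d r i v).length = v.length
  | [], _ => rfl
  | a :: v, i => by simp [mdel, aux_len d r v]

theorem aux_lenW (d : A → Q → Q) (r : Q → A → A) (s : List A) (v : List Q) :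
    (mdelW d r s v).length = v.length := by
  induction s generalizing v with
  | nil => rfl
  | cons i s ih => rw [mdelW, ih, aux_len]

theorem aux_app (d : A → Q → Q) (r : Q → A → A) :
    ∀ (v : List Q) (x : Q) (i : A), ∃ y, mdel d r i (v ++ [x]) = mdel d r i v ++ [y]
  | [], x, i => ⟨d i x, rfl⟩
  | a :: v, x, i => by
    obtain ⟨y, hy⟩ := aux_app d r v x (r a i)
    exact ⟨y, by simp [mdel, hy]⟩

theorem aux_appW (d : A → Q → Q) (r : Q → A → A) (s : List A) (v : List Q) (x : Q) :
    ∃ y, mdelW d r s (v ++ [x]) = mdelW d r s v ++ [y] := by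
  induction s generalizing v x with
  | nil => exact ⟨x, rfl⟩
  | cons i s ih =>
    obtain ⟨y, hy⟩ := aux_app d r v x i
    simp only [mdelW, hy]
    exact ih _ _

theorem aux_dropW (d : A → Q → Q) (r : Q → A → A) (s : List A) (w : List Q) :
    (mdelW d r s w).dropLast = mdelW d r s w.dropLast := by
  rcases List.eq_nil_or_concat w with rfl | ⟨v, x, rfl⟩
  · have h : mdelW d r s [] = [] := List.length_eq_zero_iff.1 (aux_lenW d r s [])
    simp [h]
  · simp only [List.concat_eq_append]
    obtain ⟨y, hy⟩ := aux_appW d r s v x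
    simp [hy]

theorem aux_comp (d : A → Q → Q) (r : Q → A → A) (s t : List A) (w : List Q) :
    mdelW d r (s ++ t) w = mdelW d r t (mdelW d r s w) := by
  induction s generalizing w with
  | nil => rfl
  | cons i s ih => exact ih _

theorem aux_closed (d : A → Q → Q) (r : Q → A → A) (u w : List Q) (s : List A)
    (h : w ∈ mOrbit d r u) : mdelW d r s w ∈ mOrbit d r u := by
  obtain ⟨t, rfl⟩ := h
  exact ⟨t ++ s, aux_comp d r t s u⟩

theorem aux_fin [Fintype Q] (d : A → Q → Q) (r : Q → A → A) (u : List Q) :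
    (mOrbit d r u).Finite := by
  refine (List.finite_length_eq Q u.length).subset ?_
  rintro _ ⟨s, rfl⟩
  exact aux_lenW d r s u

theorem aux_symm [Fintype Q] (d : A → Q → Q) (r : Q → A → A) (hrev : MReversible d)
    (u v : List Q) (h : v ∈ mOrbit d r u) : u ∈ mOrbit d r v := by
  obtain ⟨s, rfl⟩ := h
  have hm : Set.MapsTo (mdelW d r s) (mOrbit d r (mdelW d r s u)) (mOrbit d r (mdelW d r s u)) :=
    fun w hw => aux_closed d r _ w s hw
  have hs := ((aux_fin d r (mdelW d r s u)).injOn_iff_bijOn_of_mapsTo hm).1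
    (aux_injW d r hrev s).injOn
  obtain ⟨w, hw, e⟩ := hs.surjOn (show mdelW d r s u ∈ mOrbit d r (mdelW d r s u) from ⟨[], rfl⟩)
  rwa [aux_injW d r hrev s e] at hw

theorem aux_le [Fintype Q] (d : A → Q → Q) (r : Q → A → A) (hrev : MReversible d)
    (z v w : List Q) (h : w ∈ mOrbit d r v) :
    {a ∈ mOrbit d r z | a.dropLast = v}.ncard ≤ {a ∈ mOrbit d r z | a.dropLast = w}.ncard := by
  obtain ⟨s, rfl⟩ := h
  refine Set.ncard_le_ncard_of_injOn (mdelW d r s) ?_ (aux_injW d r hrev s).injOn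
    ((aux_fin d r z).subset fun a ha => ha.1)
  rintro a ⟨ha, rfl⟩
  exact ⟨aux_closed d r z a s ha, aux_dropW d r s a⟩


/-- For a reversible Mealy automaton, `u ∈ Q^n` (`n ≥ 1`) and `x ∈ Q`: every word `v` of
the component `C` of `u` extends by a letter to a word of the component `D` of `u·x`,
and `#C` divides `#D`. -/
theorem statement3 [Fintype Q] [Fintype A] [Nonempty Q] [Nonempty A]
    (d : A → Q → Q) (r : Q → A → A) (hrev : MReversible d)
    (u : List Q) (hu : u ≠ []) (x : Q) :
    (∀ v ∈ mOrbit d r u, ∃ y : Q, v ++ [y] ∈ mOrbit d r (u ++ [x])) ∧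
      (mOrbit d r u).ncard ∣ (mOrbit d r (u ++ [x])).ncard := by
  classical
  refine ⟨?_, ?_⟩
  · rintro _ ⟨s, rfl⟩
    obtain ⟨y, hy⟩ := aux_appW d r s u x
    exact ⟨y, s, hy⟩
  · have hC := aux_fin d r u
    have hD := aux_fin d r (u ++ [x])
    rw [Set.ncard_eq_toFinset_card _ hC, Set.ncard_eq_toFinset_card _ hD]
    have hmap : ∀ a ∈ hD.toFinset, a.dropLast ∈ hC.toFinset := by
      intro a ha
      rw [Set.Finite.mem_toFinset] at ha ⊢
      obtain ⟨s, rfl⟩ := ha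
      exact ⟨s, by rw [aux_dropW]; simp⟩
    rw [Finset.card_eq_sum_card_fiberwise hmap,
      Finset.sum_const_nat (m := {a ∈ mOrbit d r (u ++ [x]) | a.dropLast = u}.ncard)]
    · exact Dvd.intro _ rfl
    · intro v hv
      rw [Set.Finite.mem_toFinset] at hv
      rw [← le_antisymm (aux_le d r hrev (u ++ [x]) v u (aux_symm d r hrev u v hv))
        (aux_le d r hrev (u ++ [x]) u v hv), ← Set.ncard_coe_finset]
      congr 1
      ext a
      simp
end

section
/- Let A be an invertible and reversible Mealy automaton. The semigroup ⟨A⟩_+ generated by A admits an element of infinite order if and only if the orbit tree o(A) admits an active self-liftable branch. -/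
open List

variable {Q A : Type*}

/-- Prefix of length `m` of the infinite word `α : ℕ → Q`. -/
def branchPrefix (α : ℕ → Q) (m : ℕ) : List Q := (List.range m).map α

/-- The orbit tree admits an active self-liftable branch: a branch, represented by
an infinite word `α`, which is `k`-self-liftable for some `k ≥ 1` (every edge at
level `j + k` of the branch is liftable to the edge at level `j`), and active
(its label sequence is not eventually `1`, i.e. the sizes of the components of the
prefixes do not become eventually constant). -/
def HasActiveSelfLiftableBranch (d : A → Q → Q) (r : Q → A → A) : Prop :=
  ∃ (α : ℕ → Q) (k : ℕ), 1 ≤ k ∧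
    (∀ j : ℕ, 1 ≤ j → EdgeLiftable d r (branchPrefix α (j + k)) (branchPrefix α j)) ∧
    ∀ N : ℕ, ∃ m : ℕ, N ≤ m ∧
      (mOrbit d r (branchPrefix α (m + 1))).ncard ≠ (mOrbit d r (branchPrefix α m)).ncard

section Helpers

variable (d : A → Q → Q) (r : Q → A → A)

def rW (r : Q → A → A) : List Q → A → A
  | [], i => i
  | x :: u, i => rW r u (r x i)

theorem mrho_length (x : Q) (s : List A) : (mrho d r x s).length = s.length := by
  induction s generalizing x with
  | nil => rfl
  | cons i s ih => simp [mrho, ih]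

theorem mdel_length (i : A) (u : List Q) : (mdel d r i u).length = u.length := by
  induction u generalizing i with
  | nil => rfl
  | cons x u ih => simp [mdel, ih]

theorem mdelW_length (s : List A) (u : List Q) : (mdelW d r s u).length = u.length := by
  induction s generalizing u with
  | nil => rfl
  | cons i s ih => simp [mdelW, ih, mdel_length]

theorem mrhoW_nil (u : List Q) : mrhoW d r u [] = [] := by
  induction u with
  | nil => rfl
  | cons x u ih => simp [mrhoW, mrho, ih]

theorem mrhoW_cons (u : List Q) (i : A) (s : List A) :
    mrhoW d r u (i :: s) = rW r u i :: mrhoW d r (mdel d r i u) s := by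
  induction u generalizing i s with
  | nil => rfl
  | cons x u ih => simp [mrhoW, mrho, ih, rW, mdel]

theorem mdel_append (i : A) (u v : List Q) :
    mdel d r i (u ++ v) = mdel d r i u ++ mdel d r (rW r u i) v := by
  induction u generalizing i with
  | nil => rfl
  | cons x u ih => simp [mdel, rW, ih]

theorem mdelW_nil (s : List A) : mdelW d r s [] = [] := by
  induction s with
  | nil => rfl
  | cons i s ih => simp [mdelW, mdel, ih]

theorem mdelW_append (s : List A) (u v : List Q) :
    mdelW d r s (u ++ v) = mdelW d r s u ++ mdelW d r (mrhoW d r u s) v := by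
  induction s generalizing u v with
  | nil => simp [mdelW, mrhoW_nil]
  | cons i s ih => simp [mdelW, mrhoW_cons, mdel_append, ih]

theorem mrhoW_append (u v : List Q) (s : List A) :
    mrhoW d r (u ++ v) s = mrhoW d r v (mrhoW d r u s) := by
  induction u generalizing s with
  | nil => rfl
  | cons x u ih => simp [mrhoW, ih]

theorem mdelW_append' (s t : List A) (u : List Q) :
    mdelW d r (s ++ t) u = mdelW d r t (mdelW d r s u) := by
  induction s generalizing u with
  | nil => rfl
  | cons x s ih => simp [mdelW, ih]

variable {d r}

theorem mrho_inj (hinv : MInvertible r) (x : Q) : Function.Injective (mrho d r x) := by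
  intro s t h
  induction s generalizing x t with
  | nil => cases t <;> simp_all [mrho]
  | cons i s ih =>
    cases t with
    | nil => simp [mrho] at h
    | cons j t =>
      simp only [mrho, List.cons.injEq] at h
      obtain rfl := (hinv x).1 h.1
      rw [ih _ h.2]

theorem mrhoW_inj (hinv : MInvertible r) (u : List Q) : Function.Injective (mrhoW d r u) := by
  intro s t h
  induction u generalizing s t with
  | nil => exact h
  | cons x u ih => exact mrho_inj hinv x (ih h)

theorem mdel_inj (hrev : MReversible d) (i : A) : Function.Injective (mdel d r i) := by
  intro s t h
  induction s generalizing i t with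
  | nil => cases t <;> simp_all [mdel]
  | cons x s ih =>
    cases t with
    | nil => simp [mdel] at h
    | cons y t =>
      simp only [mdel, List.cons.injEq] at h
      obtain rfl := (hrev i).1 h.1
      rw [ih _ h.2]

theorem mdelW_inj (hrev : MReversible d) (s : List A) : Function.Injective (mdelW d r s) := by
  intro u v h
  induction s generalizing u v with
  | nil => exact h
  | cons x s ih => exact mdel_inj hrev x (ih h)

theorem mOrbit_self (u : List Q) : u ∈ mOrbit d r u := ⟨[], rfl⟩

theorem mOrbit_length {u v : List Q} (h : v ∈ mOrbit d r u) : v.length = u.length := by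
  obtain ⟨s, rfl⟩ := h
  exact mdelW_length d r s u

theorem mOrbit_trans {u v w : List Q} (h : v ∈ mOrbit d r u) (h' : w ∈ mOrbit d r v) :
    w ∈ mOrbit d r u := by
  obtain ⟨s, rfl⟩ := h
  obtain ⟨t, rfl⟩ := h'
  exact ⟨s ++ t, mdelW_append' d r s t u⟩

theorem mOrbit_finite [Finite Q] (u : List Q) : (mOrbit d r u).Finite :=
  (List.finite_length_eq Q u.length).subset fun _ h => mOrbit_length h

theorem mOrbit_iter (s : List A) (n : ℕ) (u : List Q) : (mdelW d r s)^[n] u ∈ mOrbit d r u := by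
  induction n with
  | zero => exact mOrbit_self u
  | succ n ih =>
    rw [Function.iterate_succ_apply']
    exact mOrbit_trans ih ⟨s, rfl⟩

theorem mOrbit_symm [Finite Q] (hrev : MReversible d) {u v : List Q} (h : v ∈ mOrbit d r u) :
    u ∈ mOrbit d r v := by
  obtain ⟨s, rfl⟩ := h
  obtain ⟨a, b, hab, h⟩ := Set.Finite.exists_lt_map_eq_of_forall_mem
    (f := fun n : ℕ => (mdelW d r s)^[n] u) (fun n => mOrbit_iter s n u) (mOrbit_finite u)
  obtain ⟨c, rfl⟩ := Nat.exists_eq_add_of_lt hab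
  rw [show a + c + 1 = a + (c + 1) by ring, Function.iterate_add_apply] at h
  have := (mdelW_inj hrev s).iterate a h
  rw [Function.iterate_succ_apply] at this
  have h2 := mOrbit_iter (d := d) (r := r) s c (mdelW d r s u)
  rwa [← this] at h2

theorem mOrbit_eq [Finite Q] (hrev : MReversible d) {u v : List Q} (h : v ∈ mOrbit d r u) :
    mOrbit d r u = mOrbit d r v := by
  ext w
  exact ⟨fun hw => mOrbit_trans (mOrbit_symm hrev h) hw, fun hw => mOrbit_trans h hw⟩

theorem mOrbit_append_left {u v x y : List Q} (h : x ++ y ∈ mOrbit d r (u ++ v))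
    (hl : x.length = u.length) : x ∈ mOrbit d r u := by
  obtain ⟨s, hs⟩ := h
  rw [mdelW_append] at hs
  exact ⟨s, (List.append_inj hs (by rw [mdelW_length, hl])).1⟩

theorem mOrbit_append_right {u v x y : List Q} (h : x ++ y ∈ mOrbit d r (u ++ v))
    (hl : x.length = u.length) : y ∈ mOrbit d r v := by
  obtain ⟨s, hs⟩ := h
  rw [mdelW_append] at hs
  exact ⟨_, (List.append_inj hs (by rw [mdelW_length, hl])).2⟩

/-- the extensions of `x` inside the orbit of `w` -/
def WExt (d : A → Q → Q) (r : Q → A → A) (w x : List Q) : Set (List Q) :=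
  {y | x ++ y ∈ mOrbit d r w}

theorem WExt_finite [Finite Q] (w x : List Q) : (WExt d r w x).Finite := by
  refine (List.finite_length_le Q w.length).subset fun y hy => ?_
  have := mOrbit_length hy
  simp at this ⊢
  omega

theorem WExt_le [Finite Q] (hrev : MReversible d) (w x x' : List Q) (h : x' ∈ mOrbit d r x) :
    (WExt d r w x).ncard ≤ (WExt d r w x').ncard := by
  obtain ⟨s, rfl⟩ := h
  refine Set.ncard_le_ncard_of_injOn (mdelW d r (mrhoW d r x s)) ?_
    ((mdelW_inj hrev _).injOn) (WExt_finite _ _)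
  intro y hy
  refine mOrbit_trans hy ⟨s, ?_⟩
  rw [mdelW_append]

theorem WExt_card [Finite Q] (hrev : MReversible d) (u v x : List Q) (hx : x ∈ mOrbit d r u) :
    (mOrbit d r u).ncard * (WExt d r (u ++ v) x).ncard = (mOrbit d r (u ++ v)).ncard := by
  classical
  have hf := mOrbit_finite (d := d) (r := r) (u ++ v)
  have hg := mOrbit_finite (d := d) (r := r) u
  have key := Finset.card_eq_sum_card_fiberwise (f := fun w : List Q => w.take u.length)
    (s := hf.toFinset) (t := hg.toFinset) (by
      intro w hw
      simp only [Set.Finite.coe_toFinset] at hw ⊢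
      have hl := mOrbit_length hw
      refine mOrbit_append_left (x := w.take u.length) (y := w.drop u.length) (v := v) ?_ ?_
      · rwa [List.take_append_drop]
      · simp at hl ⊢; omega)
  rw [Set.ncard_eq_toFinset_card _ hf, key, Set.ncard_eq_toFinset_card _ hg,
    Finset.sum_const_nat]
  intro y hy
  have hy : y ∈ mOrbit d r u := by simpa using hy
  have e : (WExt d r (u ++ v) x).ncard = (WExt d r (u ++ v) y).ncard :=
    le_antisymm (WExt_le hrev _ _ _ (mOrbit_trans (mOrbit_symm hrev hx) hy))
      (WExt_le hrev _ _ _ (mOrbit_trans (mOrbit_symm hrev hy) hx))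
  rw [e, ← Set.ncard_coe_finset]
  symm
  refine Set.ncard_congr (fun z _ => y ++ z) ?_ ?_ ?_
  · intro z hz
    have := mOrbit_length hy
    simp only [Finset.coe_filter, Set.Finite.mem_toFinset, Set.mem_ofPred_eq]
    exact ⟨hz, by simp [← this]⟩
  · intro a b _ _ h
    simpa using h
  · intro b hb
    simp only [Finset.coe_filter, Set.Finite.mem_toFinset, Set.mem_ofPred_eq] at hb
    refine ⟨b.drop u.length, ?_, ?_⟩
    · show y ++ b.drop u.length ∈ mOrbit d r (u ++ v)
      rw [← hb.2, List.take_append_drop]; exact hb.1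
    · simp only [← hb.2, List.take_append_drop]

theorem bp_add (α : ℕ → Q) (m n : ℕ) :
    branchPrefix α (m + n) = branchPrefix α m ++ branchPrefix (fun i => α (m + i)) n := by
  simp [branchPrefix, List.range_add, Function.comp_def]

theorem bp_length (α : ℕ → Q) (m : ℕ) : (branchPrefix α m).length = m := by
  simp [branchPrefix]

theorem bp_card_pos [Finite Q] (u : List Q) : 0 < (mOrbit d r u).ncard :=
  (Set.ncard_pos (mOrbit_finite u)).2 ⟨u, mOrbit_self u⟩

theorem bp_mono [Finite Q] (hrev : MReversible d) (α : ℕ → Q) :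
    Monotone fun n => (mOrbit d r (branchPrefix α n)).ncard := by
  intro m n h
  obtain ⟨t, rfl⟩ := Nat.exists_eq_add_of_le h
  simp only
  rw [bp_add, ← WExt_card hrev _ _ _ (mOrbit_self _)]
  refine Nat.le_mul_of_pos_right _ ((Set.ncard_pos (WExt_finite _ _)).2 ⟨_, mOrbit_self _⟩)

/-- powers of a word -/
def wpow (u : List Q) : ℕ → List Q
  | 0 => []
  | n + 1 => u ++ wpow u n

theorem wpow_length (u : List Q) (n : ℕ) : (wpow u n).length = n * u.length := by
  induction n with
  | zero => simp [wpow]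
  | succ n ih => simp [wpow, ih]; ring

theorem wpow_add (u : List Q) (m n : ℕ) : wpow u (m + n) = wpow u m ++ wpow u n := by
  induction m with
  | zero => simp [wpow]
  | succ m ih => rw [show m + 1 + n = (m + n) + 1 by ring]; simp [wpow, ih]

theorem wpow_mul (u : List Q) (m n : ℕ) : wpow u (m * n) = wpow (wpow u m) n := by
  induction n with
  | zero => simp [wpow]
  | succ n ih => rw [Nat.mul_succ, Nat.add_comm, wpow_add, ih]; rfl

theorem mrhoW_wpow (u : List Q) (n : ℕ) : mrhoW d r (wpow u n) = (mrhoW d r u)^[n] := by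
  induction n with
  | zero => rfl
  | succ n ih =>
    funext s
    rw [wpow, mrhoW_append, ih, Function.iterate_succ_apply]

theorem mdelW_wpow (u : List Q) (hu : mrhoW d r u = id) (s : List A) (n : ℕ) :
    mdelW d r s (wpow u n) = wpow (mdelW d r s u) n := by
  induction n with
  | zero => simp [wpow, mdelW_nil]
  | succ n ih => simp [wpow, mdelW_append, hu, ih]

/-- finite order implies bounded orbits -/
theorem bounded_of_finite_order [Finite Q] (u : List Q) (hu : mrhoW d r u = id) (n : ℕ) :
    (mOrbit d r (wpow u n)).ncard ≤ (mOrbit d r u).ncard := by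
  have : mOrbit d r (wpow u n) ⊆ (fun v => wpow v n) '' mOrbit d r u := by
    rintro _ ⟨s, rfl⟩
    exact ⟨_, ⟨s, rfl⟩, (mdelW_wpow u hu s n).symm⟩
  exact (Set.ncard_le_ncard this ((mOrbit_finite u).image _)).trans
    (Set.ncard_image_le (mOrbit_finite u))

theorem exists_injOn {T : Type*} (S : Set T) (hS : S.Finite) (B : ℕ) (h : S.ncard ≤ B) :
    ∃ f : T → Fin (B + 1), Set.InjOn f S := by
  have hle : S.encard ≤ (Set.univ : Set (Fin (B + 1))).encard := by
    rw [← hS.cast_ncard_eq, Set.encard_univ]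
    simp
    exact_mod_cast (by omega : S.ncard ≤ B + 1)
  obtain ⟨f, -, hf⟩ := hS.exists_injOn_of_encard_le hle
  exact ⟨f, hf⟩

/-- bounded orbits imply finite order -/
theorem finite_order_of_bounded [Finite Q] [Finite A] (u : List Q) (B : ℕ)
    (hB : ∀ n, (mOrbit d r (wpow u n)).ncard ≤ B) :
    ∃ m k : ℕ, 1 ≤ m ∧ 1 ≤ k ∧ m ≠ k ∧ (mrhoW d r u)^[m] = (mrhoW d r u)^[k] := by
  choose f hf using fun n => exists_injOn _ (mOrbit_finite (d := d) (r := r) (wpow u n)) B (hB n)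
  let R : ℕ → Set (Fin (B + 1) × A × Fin (B + 1) × A) := fun n =>
    {p | ∃ v ∈ mOrbit d r (wpow u n), p.1 = f n v ∧ p.2.2.1 = f n (mdel d r p.2.1 v) ∧
      p.2.2.2 = rW r v p.2.1}
  obtain ⟨a, b, hab, h⟩ := Finite.exists_ne_map_eq_of_infinite
    (fun n : ℕ => (f (n + 1) (wpow u (n + 1)), R (n + 1)))
  simp only [Prod.mk.injEq] at h
  refine ⟨a + 1, b + 1, by omega, by omega, by omega, ?_⟩
  rw [← mrhoW_wpow, ← mrhoW_wpow]
  have key : ∀ (s : List A) (v w : List Q), v ∈ mOrbit d r (wpow u (a + 1)) →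
      w ∈ mOrbit d r (wpow u (b + 1)) → f (a + 1) v = f (b + 1) w →
      mrhoW d r v s = mrhoW d r w s := by
    intro s
    induction s with
    | nil => intros; simp [mrhoW_nil]
    | cons i s ih =>
      intro v w hv hw hvw
      have h1 : (f (a + 1) v, i, f (a + 1) (mdel d r i v), rW r v i) ∈ R (a + 1) :=
        ⟨v, hv, rfl, rfl, rfl⟩
      rw [h.2] at h1
      obtain ⟨w', hw', e1, e2, e3⟩ := h1
      simp only at e1 e2 e3
      obtain rfl := hf _ hw hw' (hvw.symm.trans e1)
      rw [mrhoW_cons, mrhoW_cons, e3, ih (mdel d r i v) (mdel d r i w) (mOrbit_trans hv ⟨[i], rfl⟩)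
        (mOrbit_trans hw ⟨[i], rfl⟩) e2]
  funext s
  exact key s _ _ (mOrbit_self _) (mOrbit_self _) h.1

theorem forward [Finite Q] [Finite A] (hrev : MReversible d) (u : List Q) (hu : u ≠ [])
    (h : ∀ m k : ℕ, 1 ≤ m → 1 ≤ k → (mrhoW d r u)^[m] = (mrhoW d r u)^[k] → m = k) :
    HasActiveSelfLiftableBranch d r := by
  have hpos : 0 < u.length := List.length_pos_iff.2 hu
  let α : ℕ → Q := fun n => u[n % u.length]'(Nat.mod_lt _ hpos)
  have hα : (fun i => α (u.length + i)) = α := by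
    funext i; simp [α]
  have hu' : branchPrefix α u.length = u := by
    apply List.ext_getElem
    · simp [branchPrefix]
    · intro n h1 h2
      simp [branchPrefix, α, Nat.mod_eq_of_lt h2]
  have hadd : ∀ j, branchPrefix α (u.length + j) = u ++ branchPrefix α j := by
    intro j
    rw [bp_add, hu', hα]
  have hpow : ∀ n, branchPrefix α (n * u.length) = wpow u n := by
    intro n
    induction n with
    | zero => simp [branchPrefix, wpow]
    | succ n ih => rw [show (n + 1) * u.length = u.length + n * u.length by ring, hadd, ih]; rfl
  refine ⟨α, u.length, hpos, ?_, ?_⟩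
  · intro j _ v hv
    rw [Nat.add_comm, hadd] at hv
    obtain ⟨s, rfl⟩ := hv
    rw [mdelW_append]
    exact ⟨_, ⟨_, rfl⟩, List.suffix_append _ _⟩
  · by_contra! hc
    obtain ⟨N, hN⟩ := hc
    have hconst : ∀ t, (mOrbit d r (branchPrefix α (N + t))).ncard =
        (mOrbit d r (branchPrefix α N)).ncard := by
      intro t
      induction t with
      | zero => rfl
      | succ t ih => rw [← ih, ← Nat.add_assoc, hN _ (by omega)]
    obtain ⟨m, k, hm, hk, hne, he⟩ := finite_order_of_bounded (d := d) (r := r) u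
      (mOrbit d r (branchPrefix α N)).ncard (by
        intro n
        rw [← hpow, ← hconst (n * u.length)]
        exact bp_mono hrev α (by omega))
    exact hne (h m k hm hk he)

theorem backward [Finite Q] (hinv : MInvertible r) (hrev : MReversible d)
    (h : HasActiveSelfLiftableBranch d r) :
    ∃ u : List Q, u ≠ [] ∧ ∀ m k : ℕ, 1 ≤ m → 1 ≤ k →
        (mrhoW d r u)^[m] = (mrhoW d r u)^[k] → m = k := by
  obtain ⟨α, k, hk, hlift, hact⟩ := h
  set C : ℕ → Set (List Q) := fun n => mOrbit d r (branchPrefix α n) with hC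
  have hlen : ∀ {n v}, v ∈ C n → v.length = n := by
    intro n v hv
    rw [mOrbit_length hv, bp_length]
  -- suffixes
  have hS1 : ∀ j x y, x.length = k → y.length = j → x ++ y ∈ C (j + k) → y ∈ C j := by
    intro j x y hx hy hxy
    rcases Nat.eq_zero_or_pos j with rfl | hj
    · obtain rfl := List.length_eq_zero_iff.1 hy
      exact mOrbit_self _
    · obtain ⟨v', hv', hs⟩ := hlift j hj _ hxy
      have hv'' := hlen hv'
      have := List.suffix_of_suffix_length_le hs (List.suffix_append x y) (by omega)
      rwa [← this.eq_of_length (by omega)]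
  have hS : ∀ i j x y, x.length = k * i → y.length = j → x ++ y ∈ C (j + k * i) → y ∈ C j := by
    intro i
    induction i with
    | zero =>
      intro j x y hx hy h
      obtain rfl : x = [] := List.length_eq_zero_iff.1 (by simpa using hx)
      simpa using h
    | succ i ih =>
      intro j x y hx hy h
      refine ih j (x.drop k) y (by simp [hx, Nat.mul_succ]) hy ?_
      refine hS1 _ (x.take k) _ (by simp [hx, Nat.mul_succ])
        (by simp [hx, hy, Nat.mul_succ]; omega) ?_
      rw [← List.append_assoc, List.take_append_drop]
      convert h using 2
      ring
  have hP : ∀ m n x y, x.length = m → x ++ y ∈ C (m + n) → x ∈ C m := by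
    intro m n x y hx h
    simp only [hC, bp_add] at h
    exact mOrbit_append_left h (by rw [hx, bp_length])
  let E : ℕ → List Q → Set (List Q) := fun n x => WExt d r (branchPrefix α n) x
  have hE : ∀ m n x, x ∈ C m → (C m).ncard * (E (m + n) x).ncard = (C (m + n)).ncard := by
    intro m n x hx
    simp only [hC, E, bp_add]
    exact WExt_card hrev _ _ _ hx
  have hEl : ∀ m n x y, x ∈ C m → y ∈ E (m + n) x → y.length = n := by
    intro m n x y hx hy
    have h1 := hlen hx
    have h2 : (x ++ y).length = m + n := hlen hy
    simp at h2; omega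
  have hsub : ∀ i m n x y, x.length = k * i → y.length = m → x ++ y ∈ C (m + k * i) →
      E (m + k * i + n) (x ++ y) ⊆ E (m + n) y := by
    intro i m n x y hx hy hxy z hz
    have hzl := hEl _ n _ _ hxy hz
    have hz' : (x ++ y) ++ z ∈ C (m + k * i + n) := hz
    show y ++ z ∈ C (m + n)
    refine hS i (m + n) x (y ++ z) hx (by simp [hy, hzl]) ?_
    rw [← List.append_assoc]
    convert hz' using 2
    ring
  have hpos : ∀ n, 0 < (C n).ncard := fun n => bp_card_pos _
  -- block labels
  let f : ℕ → ℕ := fun i => (E (k * i + k) (branchPrefix α (k * i))).ncard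
  have hf : ∀ i, (C (k * i)).ncard * f i = (C (k * i + k)).ncard := fun i =>
    hE _ _ _ (mOrbit_self _)
  have hanti : ∀ i, f (i + 1) ≤ f i := by
    intro i
    have hx : branchPrefix α (k * (i + 1)) ∈ C (k * (i + 1)) := mOrbit_self _
    have e : k * (i + 1) = k + k * i := by ring
    have e1 : branchPrefix α (k * (i + 1)) =
      branchPrefix α k ++ branchPrefix (fun j => α (k + j)) (k * i) := by
      rw [e, bp_add]
    have hx' : branchPrefix α k ++ branchPrefix (fun j => α (k + j)) (k * i)
        ∈ C (k * i + k * 1) := by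
      rw [← e1]; convert hx using 2; ring
    have h1 := hsub 1 (k * i) k (branchPrefix α k) (branchPrefix (fun j => α (k + j)) (k * i))
      (by simp [bp_length]) (bp_length _ _) hx'
    have h2 := Set.ncard_le_ncard h1 (WExt_finite _ _)
    rw [← e1] at h2
    have hy : branchPrefix (fun j => α (k + j)) (k * i) ∈ C (k * i) :=
      hS 1 _ _ _ (by simp [bp_length]) (bp_length _ _) hx'
    have h3 := (hE (k * i) k _ hy).trans (hf i).symm
    have h4 := Nat.eq_of_mul_eq_mul_left (hpos _) h3
    rw [h4] at h2
    have e5 : k * i + k * 1 + k = k * (i + 1) + k := by ring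
    rw [e5] at h2
    exact h2
  have hanti' : Antitone f := antitone_nat_of_succ_le hanti
  obtain ⟨I, hI⟩ : ∃ I, ∀ j, f I ≤ f j := by
    refine ⟨Function.argmin f, fun j => Function.argmin_le f j⟩
  have hconst : ∀ i, f (I + i) = f I := fun i => le_antisymm (hanti' (by omega)) (hI _)
  have hgeo : ∀ t i, (C (k * (I + i) + k * t)).ncard = (C (k * (I + i))).ncard * f I ^ t := by
    intro t
    induction t with
    | zero => intro i; simp
    | succ t ih =>
      intro i
      have := hf (I + i + t)
      rw [show I + i + t = I + (i + t) by ring, hconst,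
        show k * (I + (i + t)) = k * (I + i) + k * t by ring, ih] at this
      rw [show k * (I + i) + k * (t + 1) = k * (I + i) + k * t + k by ring, ← this]
      ring
  -- gluing
  have hglue : ∀ i t y v w, y.length = k * i → v.length = k * I →
      y ++ v ∈ C (k * I + k * i) → v ++ w ∈ C (k * I + k * t) →
      y ++ v ++ w ∈ C (k * I + k * i + k * t) := by
    intro i t y v w hy hv h1 h2
    have hvC : v ∈ C (k * I) := hP _ _ _ _ hv h2
    have hs := hsub i (k * I) (k * t) y v hy hv h1
    have c1 := hE _ (k * t) _ h1
    have c2 := hE _ (k * t) _ hvC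
    have g1 := hgeo t i
    have g2 := hgeo t 0
    rw [show k * (I + i) = k * I + k * i by ring] at g1
    rw [Nat.add_zero] at g2
    rw [g1] at c1
    rw [g2] at c2
    have c1 := Nat.eq_of_mul_eq_mul_left (hpos _) c1
    have c2 := Nat.eq_of_mul_eq_mul_left (hpos _) c2
    have := Set.eq_of_subset_of_ncard_le hs (by rw [c1, c2]) (WExt_finite _ _)
    have hw : w ∈ E (k * I + k * t) v := h2
    rw [← this] at hw
    exact hw
  -- repetition
  let β : ℕ → ℕ → ℕ → Q := fun n m j => α (n + m + j)
  obtain ⟨a, b, hab, hrep⟩ := Set.Finite.exists_lt_map_eq_of_forall_mem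
    (f := fun n : ℕ => branchPrefix (fun j => α (k * n + j)) (k * I))
    (t := {l : List Q | l.length = k * I})
    (fun n => bp_length _ _) (List.finite_length_eq Q (k * I))
  obtain ⟨c, rfl⟩ := Nat.exists_eq_add_of_lt hab
  set v := branchPrefix (fun j => α (k * a + j)) (k * I) with hv
  have hvl : v.length = k * I := bp_length _ _
  set P := c + 1 with hPdef
  set w := branchPrefix (fun j => α (k * a + (k * I + j))) (k * P) with hw
  have hwl : w.length = k * P := bp_length _ _
  have hvw : v ++ w = branchPrefix (fun j => α (k * a + j)) (k * I + k * P) := by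
    rw [bp_add]
  have hvw' : v ++ w = branchPrefix (fun j => α (k * a + j)) (k * P) ++ v := by
    rw [hvw, Nat.add_comm, bp_add, hrep]
    congr 2
    funext j
    congr 1
    rw [hPdef]; ring
  have hvwC : v ++ w ∈ C (k * I + k * P) := by
    refine hS a _ (branchPrefix α (k * a)) _ (bp_length _ _) (by simp [hvl, hwl]) ?_
    rw [hvw, ← bp_add, Nat.add_comm]
    exact mOrbit_self _
  have hvC : v ∈ C (k * I) := hP _ _ _ _ hvl hvwC
  have hpw : ∀ n, ∃ y : List Q, y.length = k * (P * n) ∧ v ++ wpow w n = y ++ v ∧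
      v ++ wpow w n ∈ C (k * I + k * (P * n)) := by
    intro n
    induction n with
    | zero => exact ⟨[], by simp, by simp [wpow], by simpa [wpow] using hvC⟩
    | succ n ih =>
      obtain ⟨y, hy, he, hm⟩ := ih
      have e : v ++ wpow w (n + 1) = y ++ v ++ w := by
        rw [wpow_add, ← List.append_assoc, he]; simp [wpow]
      refine ⟨y ++ branchPrefix (fun j => α (k * a + j)) (k * P), ?_, ?_, ?_⟩
      · simp [hy, bp_length]; ring
      · rw [e, List.append_assoc, hvw', List.append_assoc]
      · rw [e]
        rw [he] at hm
        have := hglue _ P y v w hy hvl hm hvwC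
        convert this using 2
        ring
  have hwC : ∀ n, wpow w n ∈ C (k * (P * n)) := by
    intro n
    obtain ⟨y, -, -, hm⟩ := hpw n
    refine hS I _ v _ hvl (by rw [wpow_length, hwl]; ring) ?_
    rwa [Nat.add_comm]
  -- unboundedness
  have hmono : Monotone fun n => (C n).ncard := bp_mono hrev α
  have hunb : ∀ B, ∃ m, B ≤ (C m).ncard := by
    intro B
    induction B with
    | zero => exact ⟨0, Nat.zero_le _⟩
    | succ B ih =>
      obtain ⟨m, hm⟩ := ih
      obtain ⟨m', hm', hne⟩ := hact m
      refine ⟨m' + 1, ?_⟩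
      have h1 : (C m).ncard ≤ (C m').ncard := hmono hm'
      have h2 : (C m').ncard ≤ (C (m' + 1)).ncard := hmono (Nat.le_succ _)
      have h3 : (C (m' + 1)).ncard ≠ (C m').ncard := hne
      omega
  have hkP : 0 < k * P := Nat.mul_pos hk (by omega)
  have main : ∀ m p, (mrhoW d r w)^[m] = (mrhoW d r w)^[m + (p + 1)] → False := by
    intro m p he
    have hid : mrhoW d r (wpow w (p + 1)) = id := by
      rw [mrhoW_wpow]
      funext s
      have := congrFun he s
      rw [Function.iterate_add_apply] at this
      exact ((mrhoW_inj hinv w).iterate m this).symm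
    obtain ⟨M, hM⟩ := hunb ((mOrbit d r (wpow w (p + 1))).ncard + 1)
    have h1 := bounded_of_finite_order _ hid M
    rw [← wpow_mul, ← mOrbit_eq hrev (hwC ((p + 1) * M))] at h1
    have h2 : (C M).ncard ≤ (C (k * (P * ((p + 1) * M)))).ncard := by
      apply hmono
      have : 0 < k * P * (p + 1) := Nat.mul_pos hkP (by omega)
      calc M ≤ (k * P * (p + 1)) * M := Nat.le_mul_of_pos_left _ this
        _ = _ := by ring
    have h3 : (C (k * (P * ((p + 1) * M)))).ncard ≤ (mOrbit d r (wpow w (p + 1))).ncard := h1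
    omega
  refine ⟨w, by rintro h0; rw [h0] at hwl; simp at hwl; omega, ?_⟩
  intro m n _ _ he
  rcases lt_trichotomy m n with hlt | heq | hlt
  · obtain ⟨p, rfl⟩ := Nat.exists_eq_add_of_lt hlt
    exact (main m p he).elim
  · exact heq
  · obtain ⟨p, rfl⟩ := Nat.exists_eq_add_of_lt hlt
    exact (main n p he.symm).elim

end Helpers

/-- The semigroup generated by an invertible-reversible Mealy automaton admits an element
of infinite order (i.e. some `ρ_u`, `u` non-empty, has pairwise distinct positive powers)
iff the orbit tree admits an active self-liftable branch. -/
theorem statement7 [Fintype Q] [Fintype A] [Nonempty Q] [Nonempty A]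
    (d : A → Q → Q) (r : Q → A → A)
    (hinv : MInvertible r) (hrev : MReversible d) :
    (∃ u : List Q, u ≠ [] ∧ ∀ m k : ℕ, 1 ≤ m → 1 ≤ k →
        (mrhoW d r u)^[m] = (mrhoW d r u)^[k] → m = k) ↔
      HasActiveSelfLiftableBranch d r := by
  exact ⟨fun ⟨u, hu, h⟩ => forward hrev u hu h, fun h => backward hinv hrev h⟩
end
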